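/- arXiv:2407.05653 — 6 statements merged into one kernel-verified Lean document; each statement's English description precedes it below -/
import Mathlib

section
/- Let G₁ and G₂ be simple graphs on n₁ and n₂ vertices with adjacency matrices A₁ and A₂, and let λ₁₁,…,λ₁ₙ₁ be the (real) eigenvalues of A₁ listed with multiplicity. Then for every real x with det(xI_{n₂} − A₂) ≠ 0, det(xI_{n₁(1+n₂)} − A(G₁⊠G₂)) = det(xI_{n₂} − A₂)^{n₁} · ∏_{i=1}^{n₁} [ x − λ₁ᵢ − χ_{A₂}(x)·(1+λ₁ᵢ)² ]. -/
open Matrix Polynomial Finset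
open scoped Kronecker

/-- Adjacency matrix of the closed neighborhood corona `G₁ ⊠ G₂`, given the adjacency
matrices `A₁`, `A₂` of the factors:
`[[A₁, 1ᵀ ⊗ (I + A₁)], [1 ⊗ (I + A₁), A₂ ⊗ I]]`. -/
noncomputable def cncAdj {n₁ n₂ : ℕ} (A₁ : Matrix (Fin n₁) (Fin n₁) ℝ)
    (A₂ : Matrix (Fin n₂) (Fin n₂) ℝ) :
    Matrix (Fin n₁ ⊕ Fin n₂ × Fin n₁) (Fin n₁ ⊕ Fin n₂ × Fin n₁) ℝ :=
  Matrix.fromBlocks A₁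
    (Matrix.of fun i p => (1 + A₁) i p.2)
    (Matrix.of fun p j => (1 + A₁) p.2 j)
    (A₂ ⊗ₖ (1 : Matrix (Fin n₁) (Fin n₁) ℝ))

/-- Degree matrix of the closed neighborhood corona, given the degree matrices of the factors:
`diag((n₂+1)D₁ + n₂ I, D₂ ⊗ I + I ⊗ (D₁ + I))`. -/
noncomputable def cncDeg {n₁ n₂ : ℕ} (D₁ : Matrix (Fin n₁) (Fin n₁) ℝ)
    (D₂ : Matrix (Fin n₂) (Fin n₂) ℝ) :
    Matrix (Fin n₁ ⊕ Fin n₂ × Fin n₁) (Fin n₁ ⊕ Fin n₂ × Fin n₁) ℝ :=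
  Matrix.fromBlocks (((n₂ : ℝ) + 1) • D₁ + (n₂ : ℝ) • 1) 0 0
    (D₂ ⊗ₖ (1 : Matrix (Fin n₁) (Fin n₁) ℝ) + (1 : Matrix (Fin n₂) (Fin n₂) ℝ) ⊗ₖ (D₁ + 1))

/-- Laplacian matrix of the closed neighborhood corona. -/
noncomputable def cncLap {n₁ n₂ : ℕ} (A₁ D₁ : Matrix (Fin n₁) (Fin n₁) ℝ)
    (A₂ D₂ : Matrix (Fin n₂) (Fin n₂) ℝ) :
    Matrix (Fin n₁ ⊕ Fin n₂ × Fin n₁) (Fin n₁ ⊕ Fin n₂ × Fin n₁) ℝ :=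
  cncDeg D₁ D₂ - cncAdj A₁ A₂

/-- Signless Laplacian matrix of the closed neighborhood corona. -/
noncomputable def cncSignlessLap {n₁ n₂ : ℕ} (A₁ D₁ : Matrix (Fin n₁) (Fin n₁) ℝ)
    (A₂ D₂ : Matrix (Fin n₂) (Fin n₂) ℝ) :
    Matrix (Fin n₁ ⊕ Fin n₂ × Fin n₁) (Fin n₁ ⊕ Fin n₂ × Fin n₁) ℝ :=
  cncDeg D₁ D₂ + cncAdj A₁ A₂

/-- The coronal of a matrix `M` of order `n`: the sum of all entries of `(xIₙ - M)⁻¹`,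
i.e. `1ₙᵀ (xIₙ - M)⁻¹ 1ₙ`. -/
noncomputable def coronal {n : ℕ} (M : Matrix (Fin n) (Fin n) ℝ) (x : ℝ) : ℝ :=
  ∑ i, ∑ j, (x • (1 : Matrix (Fin n) (Fin n) ℝ) - M)⁻¹ i j

/-- Signless Laplacian of a simple graph: `Q = D + A`. -/
noncomputable def signlessLap {V : Type*} [Fintype V] [DecidableEq V] (G : SimpleGraph V)
    [DecidableRel G.Adj] : Matrix V V ℝ :=
  G.degMatrix ℝ + G.adjMatrix ℝ

/-- The energy of a (symmetric) real matrix: the sum of the absolute values of the roots of its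
characteristic polynomial, counted with multiplicity.  For a real symmetric matrix the
characteristic polynomial splits over `ℝ`, so these are exactly its eigenvalues with
multiplicity. -/
noncomputable def menergy {n : Type*} [Fintype n] [DecidableEq n] (A : Matrix n n ℝ) : ℝ :=
  (A.charpoly.roots.map (fun t => |t|)).sum

/-- The determinant of a polynomial in a real symmetric matrix is the product of the values of the
polynomial at the eigenvalues. -/
theorem Matrix.IsHermitian.det_aeval {n : Type*} [Fintype n] [DecidableEq n]
    {A : Matrix n n ℝ} (hA : A.IsHermitian) (p : ℝ[X]) :
    (aeval A p).det = (A.charpoly.roots.map fun t => p.eval t).prod := by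
  rw [← cfc_polynomial p A hA.isSelfAdjoint, hA.cfc_eq, hA.roots_charpoly_eq_eigenvalues]
  simp [IsHermitian.cfc, -Unitary.conjStarAlgAut_apply]

/-- Contracting `N ⊗ I` with two blocks that do not depend on the first index multiplies the product
of the blocks by the sum of the entries of `N`. -/
theorem Matrix.of_snd_mul_kronecker_one_mul_of_snd {R m n : Type*} [CommSemiring R] [Fintype m]
    [Fintype n] [DecidableEq n] (M L : Matrix n n R) (N : Matrix m m R) :
    (of fun i (p : m × n) => M i p.2) * (N ⊗ₖ (1 : Matrix n n R)) *
        (of fun (p : m × n) j => L p.2 j) = (∑ i, ∑ j, N i j) • (M * L) := by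
  ext i j
  simp only [mul_apply, of_apply, kroneckerMap_apply, one_apply, smul_apply, smul_eq_mul,
    Fintype.sum_prod_type, mul_ite, mul_one, mul_zero, Finset.sum_ite_eq', Finset.mem_univ, if_true]
  simp only [← Finset.mul_sum]
  rw [Finset.sum_comm (f := fun i j => N i j), Finset.sum_comm, Finset.mul_sum]
  refine Finset.sum_congr rfl fun k _ => ?_
  rw [Finset.sum_mul]
  exact Finset.sum_congr rfl fun l _ => by ring

theorem det_smul_one_sub_cncAdj {n₁ n₂ : ℕ} (A₁ : Matrix (Fin n₁) (Fin n₁) ℝ)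
    (A₂ : Matrix (Fin n₂) (Fin n₂) ℝ) {x : ℝ}
    (hx : (x • (1 : Matrix (Fin n₂) (Fin n₂) ℝ) - A₂).det ≠ 0) :
    (x • (1 : Matrix (Fin n₁ ⊕ Fin n₂ × Fin n₁) (Fin n₁ ⊕ Fin n₂ × Fin n₁) ℝ)
        - cncAdj A₁ A₂).det =
      (x • (1 : Matrix (Fin n₂) (Fin n₂) ℝ) - A₂).det ^ n₁ *
        (x • 1 - A₁ - coronal A₂ x • ((1 + A₁) * (1 + A₁))).det := by
  set D := x • (1 : Matrix (Fin n₂) (Fin n₂) ℝ) - A₂ with hD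
  have hkronecker : D ⊗ₖ (1 : Matrix (Fin n₁) (Fin n₁) ℝ) =
      x • 1 - A₂ ⊗ₖ (1 : Matrix (Fin n₁) (Fin n₁) ℝ) := by
    rw [eq_sub_iff_add_eq, ← add_kronecker, hD, sub_add_cancel, smul_kronecker, one_kronecker_one]
  have hblocks : x • (1 : Matrix (Fin n₁ ⊕ Fin n₂ × Fin n₁) (Fin n₁ ⊕ Fin n₂ × Fin n₁) ℝ)
        - cncAdj A₁ A₂ =
      fromBlocks (x • 1 - A₁) (-of fun i p => (1 + A₁) i p.2) (-of fun p j => (1 + A₁) p.2 j)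
        (D ⊗ₖ (1 : Matrix (Fin n₁) (Fin n₁) ℝ)) := by
    rw [cncAdj, ← fromBlocks_one, fromBlocks_smul, sub_eq_add_neg, fromBlocks_neg, fromBlocks_add,
      hkronecker]
    simp [sub_eq_add_neg]
  have hdet : (D ⊗ₖ (1 : Matrix (Fin n₁) (Fin n₁) ℝ)).det = D.det ^ n₁ := by
    simp [det_kronecker]
  let := invertibleOfIsUnitDet (D ⊗ₖ (1 : Matrix (Fin n₁) (Fin n₁) ℝ))
    (hdet ▸ (isUnit_iff_ne_zero.mpr hx).pow n₁)
  rw [hblocks, det_fromBlocks₂₂, hdet, invOf_eq_nonsing_inv, inv_kronecker, inv_one,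
    Matrix.neg_mul, Matrix.neg_mul, Matrix.mul_neg, neg_neg, of_snd_mul_kronecker_one_mul_of_snd, coronal]

/-- Adjacency characteristic polynomial of the closed neighborhood corona:
`det(xI - A(G₁⊠G₂)) = det(xI - A₂)^{n₁} · ∏ᵢ (x - λ₁ᵢ - χ_{A₂}(x)(1+λ₁ᵢ)²)`. -/
theorem cnc_adj_charpoly {n₁ n₂ : ℕ} (G₁ : SimpleGraph (Fin n₁)) (G₂ : SimpleGraph (Fin n₂))
    [DecidableRel G₁.Adj] [DecidableRel G₂.Adj]
    (lam : Fin n₁ → ℝ)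
    (hlam : (G₁.adjMatrix ℝ).charpoly = ∏ i, (X - C (lam i))) :
    ∀ x : ℝ, (x • (1 : Matrix (Fin n₂) (Fin n₂) ℝ) - G₂.adjMatrix ℝ).det ≠ 0 →
      (x • (1 : Matrix (Fin n₁ ⊕ Fin n₂ × Fin n₁) (Fin n₁ ⊕ Fin n₂ × Fin n₁) ℝ)
          - cncAdj (G₁.adjMatrix ℝ) (G₂.adjMatrix ℝ)).det
        = (x • (1 : Matrix (Fin n₂) (Fin n₂) ℝ) - G₂.adjMatrix ℝ).det ^ n₁ *
          ∏ i, (x - lam i - coronal (G₂.adjMatrix ℝ) x * (1 + lam i) ^ 2) := by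
  intro x hx
  set A := G₁.adjMatrix ℝ
  set c := coronal (G₂.adjMatrix ℝ) x
  have hA : A.IsHermitian := by
    rw [IsHermitian, conjTranspose_eq_transpose_of_trivial, G₁.transpose_adjMatrix]
  have hp : x • 1 - A - c • ((1 + A) * (1 + A)) =
      aeval A (C x - X - C c * (1 + X) ^ 2) := by
    simp [Algebra.algebraMap_eq_smul_one, sq]
  have hroots : A.charpoly.roots = univ.val.map lam := by
    rw [hlam]
    rw [← roots_multiset_prod_X_sub_C (univ.val.map lam), Multiset.map_map]
    rfl
  rw [det_smul_one_sub_cncAdj _ _ hx, hp, hA.det_aeval, hroots, Multiset.map_map]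
  simp [Finset.prod]
end

section
/- Let G₁ and G₂ be simple graphs of the same order n whose adjacency matrices have equal characteristic polynomials (i.e., G₁ and G₂ are adjacency cospectral). Then for every simple graph G of order m, the adjacency matrices A(G₁⊠G) and A(G₂⊠G) of the closed neighborhood coronas have equal characteristic polynomials. -/
open Matrix Polynomial Finset
open scoped Kronecker

/-- Hermitian matrices with the same characteristic polynomial are similar. -/
theorem Matrix.IsHermitian.exists_conj_of_charpoly_eq {n 𝕜 : Type*} [Fintype n] [DecidableEq n]
    [RCLike 𝕜] {A B : Matrix n n 𝕜} (hA : A.IsHermitian) (hB : B.IsHermitian)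
    (h : A.charpoly = B.charpoly) :
    ∃ U V : Matrix n n 𝕜, U * V = 1 ∧ V * U = 1 ∧ B = U * A * V := by
  have heig := (hA.eigenvalues_eq_eigenvalues_iff hB).2 h
  have hconj : B = Unitary.conjStarAlgAut 𝕜 _
      (hB.eigenvectorUnitary * star hA.eigenvectorUnitary) A := by
    rw [Unitary.conjStarAlgAut_mul_apply, hA.conjStarAlgAut_star_eigenvectorUnitary, heig]
    exact hB.spectral_theorem
  rw [Unitary.conjStarAlgAut_apply] at hconj
  exact ⟨_, _, Unitary.mul_star_self_of_mem (Subtype.property _),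
    Unitary.star_mul_self_of_mem (Subtype.property _), hconj⟩

/-- Conjugating the first factor of a closed neighborhood corona conjugates the corona. -/
theorem cncAdj_conj {n m : ℕ} {U V : Matrix (Fin n) (Fin n) ℝ} (hUV : U * V = 1)
    (A : Matrix (Fin n) (Fin n) ℝ) (B : Matrix (Fin m) (Fin m) ℝ) :
    cncAdj (U * A * V) B =
      fromBlocks U 0 0 ((1 : Matrix (Fin m) (Fin m) ℝ) ⊗ₖ U) * cncAdj A B *
        fromBlocks V 0 0 ((1 : Matrix (Fin m) (Fin m) ℝ) ⊗ₖ V) := by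
  have hone : 1 + U * A * V = U * (1 + A) * V := by
    rw [mul_add, add_mul, mul_one, hUV]
  rw [cncAdj, cncAdj, fromBlocks_multiply, fromBlocks_multiply, hone]
  simp only [Matrix.zero_mul, Matrix.mul_zero, add_zero, zero_add]
  congr 1
  · ext i ⟨p, j⟩
    simp [mul_apply, kroneckerMap_apply, one_apply, Fintype.sum_prod_type]
  · ext ⟨p, i⟩ j
    simp [mul_apply, kroneckerMap_apply, one_apply, Fintype.sum_prod_type]
  · rw [← mul_kronecker_mul, ← mul_kronecker_mul]
    simp [hUV]

/-- The characteristic polynomial of a closed neighborhood corona is invariant under similarity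
of the first factor. -/
theorem charpoly_cncAdj_conj {n m : ℕ} {U V : Matrix (Fin n) (Fin n) ℝ} (hUV : U * V = 1)
    (hVU : V * U = 1) (A : Matrix (Fin n) (Fin n) ℝ) (B : Matrix (Fin m) (Fin m) ℝ) :
    (cncAdj (U * A * V) B).charpoly = (cncAdj A B).charpoly := by
  rw [cncAdj_conj hUV, charpoly_mul_comm, ← mul_assoc, fromBlocks_multiply]
  simp [← mul_kronecker_mul, hVU]

/-- If `G₁` and `G₂` are adjacency cospectral, then `G₁ ⊠ G` and `G₂ ⊠ G` are adjacency
cospectral for every graph `G`. -/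
theorem cnc_adj_cospectral_left {n m : ℕ} (G₁ G₂ : SimpleGraph (Fin n))
    [DecidableRel G₁.Adj] [DecidableRel G₂.Adj]
    (h : (G₁.adjMatrix ℝ).charpoly = (G₂.adjMatrix ℝ).charpoly)
    (G : SimpleGraph (Fin m)) [DecidableRel G.Adj] :
    (cncAdj (G₁.adjMatrix ℝ) (G.adjMatrix ℝ)).charpoly
      = (cncAdj (G₂.adjMatrix ℝ) (G.adjMatrix ℝ)).charpoly := by
  obtain ⟨U, V, hUV, hVU, hconj⟩ :=
    (G₁.isHermitian_adjMatrix ℝ).exists_conj_of_charpoly_eq (G₂.isHermitian_adjMatrix ℝ) h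
  rw [hconj, charpoly_cncAdj_conj hUV hVU]
end

section
/- Let G₁ and G₂ be simple graphs of the same order n that are adjacency cospectral and have equal adjacency coronals, i.e., χ_{A₁}(x) = χ_{A₂}(x) for every real x with det(xIₙ − A₁) ≠ 0 and det(xIₙ − A₂) ≠ 0. Then for every simple graph G of order m, the adjacency matrices A(G⊠G₁) and A(G⊠G₂) of the closed neighborhood coronas have equal characteristic polynomials. -/
open Matrix Polynomial Finset
open scoped Kronecker

theorem det_smul_one_sub {ι : Type*} [Fintype ι] [DecidableEq ι] (M : Matrix ι ι ℝ) (x : ℝ) :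
    (x • (1 : Matrix ι ι ℝ) - M).det = M.charpoly.eval x := by
  rw [eval_charpoly, smul_one_eq_diagonal, scalar_apply]

/-- Schur complement factorization of the characteristic polynomial of a closed neighborhood
corona at a point which is not an eigenvalue of the second factor. -/
theorem eval_charpoly_cncAdj {m n : ℕ} (A : Matrix (Fin m) (Fin m) ℝ)
    (B : Matrix (Fin n) (Fin n) ℝ) (x : ℝ)
    (hx : (x • (1 : Matrix (Fin n) (Fin n) ℝ) - B).det ≠ 0) :
    (cncAdj A B).charpoly.eval x = B.charpoly.eval x ^ m *
      (x • (1 : Matrix (Fin m) (Fin m) ℝ) - A - coronal B x • ((1 + A) * (1 + A))).det := by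
  have hblocks : Matrix.scalar (Fin m ⊕ Fin n × Fin m) x - cncAdj A B =
      Matrix.fromBlocks (x • (1 : Matrix (Fin m) (Fin m) ℝ) - A)
        (-Matrix.of fun i p => (1 + A) i p.2) (-Matrix.of fun p j => (1 + A) p.2 j)
        ((x • (1 : Matrix (Fin n) (Fin n) ℝ) - B) ⊗ₖ (1 : Matrix (Fin m) (Fin m) ℝ)) := by
    ext (i | ⟨a, i⟩) (j | ⟨b, j⟩) <;>
      simp [cncAdj, scalar_apply, diagonal_apply, one_apply, Prod.ext_iff]
    grind
  have hdet : IsUnit ((x • (1 : Matrix (Fin n) (Fin n) ℝ) - B) ⊗ₖ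
      (1 : Matrix (Fin m) (Fin m) ℝ)).det := by
    simpa [det_kronecker] using pow_ne_zero m hx
  let := invertibleOfIsUnitDet _ hdet
  have hschur : (Matrix.of fun i (p : Fin n × Fin m) => (1 + A) i p.2) *
      ((x • (1 : Matrix (Fin n) (Fin n) ℝ) - B)⁻¹ ⊗ₖ (1 : Matrix (Fin m) (Fin m) ℝ)) *
      (Matrix.of fun (p : Fin n × Fin m) j => (1 + A) p.2 j) =
      coronal B x • ((1 + A) * (1 + A)) := by
    ext i j
    simp only [mul_apply, of_apply, kronecker_apply, Fintype.sum_prod_type, one_apply, coronal,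
      Matrix.smul_apply, smul_eq_mul, mul_ite, mul_one, mul_zero, Finset.sum_ite_eq',
      Finset.mem_univ, if_true]
    rw [Finset.sum_comm (f := fun a b => (x • (1 : Matrix (Fin n) (Fin n) ℝ) - B)⁻¹ a b),
      Finset.sum_mul]
    refine Finset.sum_congr rfl fun b _ => ?_
    rw [Finset.mul_sum]
    refine Finset.sum_congr rfl fun k _ => ?_
    rw [← Finset.mul_sum]
    ring
  rw [eval_charpoly, hblocks, det_fromBlocks₂₂, invOf_eq_nonsing_inv, inv_kronecker, inv_one,
    Matrix.neg_mul, Matrix.neg_mul, Matrix.mul_neg, neg_neg, hschur, det_kronecker, det_one,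
    one_pow, mul_one, det_smul_one_sub, Fintype.card_fin]

/-- If `G₁` and `G₂` are adjacency cospectral with equal adjacency coronals, then
`G ⊠ G₁` and `G ⊠ G₂` are adjacency cospectral for every graph `G`. -/
theorem cnc_adj_cospectral_right {n m : ℕ} (G₁ G₂ : SimpleGraph (Fin n))
    [DecidableRel G₁.Adj] [DecidableRel G₂.Adj]
    (h : (G₁.adjMatrix ℝ).charpoly = (G₂.adjMatrix ℝ).charpoly)
    (hcor : ∀ x : ℝ, (x • (1 : Matrix (Fin n) (Fin n) ℝ) - G₁.adjMatrix ℝ).det ≠ 0 →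
      (x • (1 : Matrix (Fin n) (Fin n) ℝ) - G₂.adjMatrix ℝ).det ≠ 0 →
      coronal (G₁.adjMatrix ℝ) x = coronal (G₂.adjMatrix ℝ) x)
    (G : SimpleGraph (Fin m)) [DecidableRel G.Adj] :
    (cncAdj (G.adjMatrix ℝ) (G₁.adjMatrix ℝ)).charpoly
      = (cncAdj (G.adjMatrix ℝ) (G₂.adjMatrix ℝ)).charpoly := by
  have hne : (G₁.adjMatrix ℝ).charpoly ≠ 0 := (charpoly_monic _).ne_zero
  refine mul_right_cancel₀ hne (Polynomial.funext fun x => ?_)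
  simp only [eval_mul]
  by_cases hx : (G₁.adjMatrix ℝ).charpoly.eval x = 0
  · simp [hx]
  · have h₁ := (det_smul_one_sub (G₁.adjMatrix ℝ) x).trans_ne hx
    have h₂ := (det_smul_one_sub (G₂.adjMatrix ℝ) x).trans_ne (h ▸ hx)
    rw [eval_charpoly_cncAdj _ _ x h₁, eval_charpoly_cncAdj _ _ x h₂, hcor x h₁ h₂, h]
end

section
/- Let G₁ be an r₁-regular simple graph of order n₁ (so its degree matrix is D₁ = r₁I_{n₁}) with Laplacian eigenvalues γ₁₁,…,γ₁ₙ₁ listed with multiplicity, and let G₂ be an arbitrary simple graph of order n₂ with Laplacian matrix L₂. Then for every real x with det((x−r₁−1)I_{n₂} − L₂) ≠ 0, det(xI_{n₁(1+n₂)} − L(G₁⊠G₂)) = det((x−(r₁+1))I_{n₂} − L₂)^{n₁} · ∏_{i=1}^{n₁} [ x − n₂(r₁+1) − γ₁ᵢ − χ_{L₂}(x−(r₁+1))·(r₁+1−γ₁ᵢ)² ]. -/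
open Matrix Polynomial Finset
open scoped Kronecker

namespace Matrix

/-- The determinant of a polynomial in a real symmetric matrix is the product of the values of the
polynomial at the eigenvalues. -/
theorem IsHermitian.det_aeval_s4 {n : Type*} [Fintype n] [DecidableEq n] {A : Matrix n n ℝ}
    (hA : A.IsHermitian) (p : ℝ[X]) :
    (aeval A p).det = (A.charpoly.roots.map fun t => p.eval t).prod := by
  have key : (aeval A p).det = (aeval (diagonal hA.eigenvalues) p).det := by
    have h : A = Unitary.conjStarAlgAut ℝ _ hA.eigenvectorUnitary (diagonal hA.eigenvalues) :=
      hA.spectral_theorem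
    conv_lhs => rw [h, aeval_algHom_apply, Unitary.conjStarAlgAut_apply, det_mul_right_comm]
    simp
  have hdiag : aeval (diagonal hA.eigenvalues) p = diagonal fun i => p.eval (hA.eigenvalues i) := by
    have h := aeval_algHom_apply (diagonalAlgHom ℝ (n := n) (α := ℝ)) hA.eigenvalues p
    simp only [diagonalAlgHom_apply] at h
    rw [h]
    congr 1
    ext i
    simp
  rw [key, hdiag, det_diagonal, hA.roots_charpoly_eq_eigenvalues]
  simp

end Matrix

/-- Compressing `N ⊗ I` by the all-ones vector, `(1ᵀ ⊗ B) (N ⊗ I) (1 ⊗ C)`, multiplies `B C` by the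
sum of the entries of `N`. -/
theorem mul_kronecker_one_mul {l m : Type*} [Fintype l] [Fintype m] [DecidableEq m]
    (B C : Matrix m m ℝ) (N : Matrix l l ℝ) :
    (Matrix.of fun (i : m) (p : l × m) => B i p.2) * (N ⊗ₖ (1 : Matrix m m ℝ)) *
      (Matrix.of fun (p : l × m) (j : m) => C p.2 j) = (∑ i, ∑ j, N i j) • (B * C) := by
  ext i j
  simp only [Matrix.mul_apply, Fintype.sum_prod_type, Matrix.of_apply, kroneckerMap_apply,
    Matrix.one_apply, Matrix.smul_apply, smul_eq_mul, mul_ite, mul_one, mul_zero,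
    Finset.sum_ite_eq', Finset.mem_univ, if_true]
  rw [Finset.sum_comm (f := fun i j => N i j), Finset.sum_mul]
  refine Finset.sum_congr rfl fun a _ => ?_
  rw [Finset.mul_sum]
  refine Finset.sum_congr rfl fun k _ => ?_
  rw [← Finset.mul_sum]
  ring

/-- The block form of `xI - L(G₁ ⊠ G₂)` when the first factor is `r`-regular. -/
theorem smul_one_sub_cncLap {n₁ n₂ : ℕ} (A₁ : Matrix (Fin n₁) (Fin n₁) ℝ)
    (A₂ D₂ : Matrix (Fin n₂) (Fin n₂) ℝ) (r x : ℝ) :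
    x • 1 - cncLap A₁ (r • 1) A₂ D₂ = Matrix.fromBlocks
      ((x - n₂ * (r + 1)) • 1 - (r • 1 - A₁))
      (Matrix.of fun i p => (1 + A₁) i p.2) (Matrix.of fun p j => (1 + A₁) p.2 j)
      (((x - (r + 1)) • 1 - (D₂ - A₂)) ⊗ₖ (1 : Matrix (Fin n₁) (Fin n₁) ℝ)) := by
  ext (i | ⟨i, k⟩) (j | ⟨j, l⟩)
  · simp [cncLap, cncDeg, cncAdj, Matrix.one_apply]
    split_ifs <;> ring
  · simp [cncLap, cncDeg, cncAdj, Matrix.one_apply]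
  · simp [cncLap, cncDeg, cncAdj, Matrix.one_apply]
  · simp [cncLap, cncDeg, cncAdj, Matrix.one_apply, Prod.ext_iff]
    split_ifs <;> simp_all
    ring

/-- Laplacian characteristic polynomial of the closed neighborhood corona, for `G₁`
an `r₁`-regular graph. -/
theorem cnc_lap_charpoly {n₁ n₂ r₁ : ℕ} (G₁ : SimpleGraph (Fin n₁)) (G₂ : SimpleGraph (Fin n₂))
    [DecidableRel G₁.Adj] [DecidableRel G₂.Adj]
    (hreg : G₁.IsRegularOfDegree r₁)
    (gam : Fin n₁ → ℝ)
    (hgam : (G₁.lapMatrix ℝ).charpoly = ∏ i, (X - C (gam i))) :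
    ∀ x : ℝ,
      ((x - (r₁ : ℝ) - 1) • (1 : Matrix (Fin n₂) (Fin n₂) ℝ) - G₂.lapMatrix ℝ).det ≠ 0 →
      (x • (1 : Matrix (Fin n₁ ⊕ Fin n₂ × Fin n₁) (Fin n₁ ⊕ Fin n₂ × Fin n₁) ℝ)
          - cncLap (G₁.adjMatrix ℝ) (G₁.degMatrix ℝ) (G₂.adjMatrix ℝ) (G₂.degMatrix ℝ)).det
        = ((x - ((r₁ : ℝ) + 1)) • (1 : Matrix (Fin n₂) (Fin n₂) ℝ) - G₂.lapMatrix ℝ).det ^ n₁ *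
          ∏ i, (x - n₂ * ((r₁ : ℝ) + 1) - gam i
              - coronal (G₂.lapMatrix ℝ) (x - ((r₁ : ℝ) + 1)) * ((r₁ : ℝ) + 1 - gam i) ^ 2) := by
  intro x hx
  rw [sub_sub] at hx
  have hD : G₁.degMatrix ℝ = (r₁ : ℝ) • 1 := by
    ext i j
    simp [SimpleGraph.degMatrix, Matrix.diagonal_apply, Matrix.one_apply, hreg.degree_eq]
  have hL : G₁.lapMatrix ℝ = (r₁ : ℝ) • 1 - G₁.adjMatrix ℝ := by
    rw [SimpleGraph.lapMatrix, hD]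
  set N := (x - ((r₁ : ℝ) + 1)) • (1 : Matrix (Fin n₂) (Fin n₂) ℝ) - G₂.lapMatrix ℝ with hN
  have hNdet : (N ⊗ₖ (1 : Matrix (Fin n₁) (Fin n₁) ℝ)).det = N.det ^ n₁ := by
    simp [det_kronecker]
  have hunit : IsUnit (N ⊗ₖ (1 : Matrix (Fin n₁) (Fin n₁) ℝ)).det := by
    rw [hNdet]
    exact (pow_ne_zero _ hx).isUnit
  let _ := Matrix.invertibleOfIsUnitDet _ hunit
  let p : ℝ[X] := C (x - n₂ * ((r₁ : ℝ) + 1)) - X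
    - C (coronal (G₂.lapMatrix ℝ) (x - ((r₁ : ℝ) + 1))) * (C ((r₁ : ℝ) + 1) - X) ^ 2
  have hp : aeval (G₁.lapMatrix ℝ) p = (x - n₂ * ((r₁ : ℝ) + 1)) • 1 - G₁.lapMatrix ℝ
      - coronal (G₂.lapMatrix ℝ) (x - ((r₁ : ℝ) + 1)) •
        ((1 + G₁.adjMatrix ℝ) * (1 + G₁.adjMatrix ℝ)) := by
    have hA : 1 + G₁.adjMatrix ℝ = ((r₁ : ℝ) + 1) • 1 - G₁.lapMatrix ℝ := by
      rw [hL, add_smul, one_smul]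
      abel
    simp only [p, hA, map_sub (aeval _), map_mul (aeval _), aeval_C, aeval_X, Algebra.algebraMap_eq_smul_one,
      smul_mul_assoc, one_mul, pow_two]
  have hroots : (G₁.lapMatrix ℝ).charpoly.roots = univ.val.map gam := by
    rw [hgam, ← roots_multiset_prod_X_sub_C (univ.val.map gam), Multiset.map_map]
    rfl
  have hblock := smul_one_sub_cncLap (G₁.adjMatrix ℝ) (G₂.adjMatrix ℝ) (G₂.degMatrix ℝ) r₁ x
  rw [← hL, ← SimpleGraph.lapMatrix, ← hN] at hblock
  rw [hD, hblock, det_fromBlocks₂₂, hNdet, invOf_eq_nonsing_inv, inv_kronecker, inv_one,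
    mul_kronecker_one_mul, hN, ← coronal, ← hp, (G₁.isHermitian_lapMatrix ℝ).det_aeval_s4, hroots]
  simp [p, List.prod_ofFn]
end

section
/- Let G₁ and G₂ be r-regular simple graphs of the same order n whose Laplacian matrices have equal characteristic polynomials (i.e., G₁ and G₂ are Laplacian cospectral). Then for every simple graph G of order m, the Laplacian matrices L(G₁⊠G) and L(G₂⊠G) of the closed neighborhood coronas have equal characteristic polynomials. -/
open Matrix Polynomial Finset
open scoped Kronecker

/-- Hermitian matrices with the same characteristic polynomial are unitarily similar. -/
theorem Matrix.IsHermitian.exists_unitary_conj_of_charpoly_eq {𝕜 ι : Type*} [RCLike 𝕜]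
    [Fintype ι] [DecidableEq ι] {A B : Matrix ι ι 𝕜} (hA : A.IsHermitian) (hB : B.IsHermitian)
    (h : A.charpoly = B.charpoly) :
    ∃ U : Matrix.unitaryGroup ι 𝕜, B = Unitary.conjStarAlgAut 𝕜 _ U A := by
  refine ⟨hB.eigenvectorUnitary * star hA.eigenvectorUnitary, ?_⟩
  rw [Unitary.conjStarAlgAut_mul_apply, hA.conjStarAlgAut_star_eigenvectorUnitary,
    (hA.eigenvalues_eq_eigenvalues_iff hB).2 h]
  exact hB.spectral_theorem

theorem SimpleGraph.IsRegularOfDegree.degMatrix_eq {V : Type*} [Fintype V] [DecidableEq V]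
    (R : Type*) [Semiring R] {G : SimpleGraph V} [DecidableRel G.Adj] {r : ℕ}
    (hG : G.IsRegularOfDegree r) : G.degMatrix R = (r : R) • (1 : Matrix V V R) := by
  ext i j
  simp [SimpleGraph.degMatrix, Matrix.diagonal_apply, Matrix.one_apply, hG.degree_eq i]

/-- Conjugating the first factor of a closed neighborhood corona by `U` conjugates its Laplacian
by `diag(U, I ⊗ U)`. -/
theorem cncLap_conj {n m : ℕ} {U V : Matrix (Fin n) (Fin n) ℝ} (hUV : U * V = 1)
    (A D : Matrix (Fin n) (Fin n) ℝ) (A₂ D₂ : Matrix (Fin m) (Fin m) ℝ) :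
    cncLap (U * A * V) (U * D * V) A₂ D₂ =
      fromBlocks U 0 0 ((1 : Matrix (Fin m) (Fin m) ℝ) ⊗ₖ U) * cncLap A D A₂ D₂ *
        fromBlocks V 0 0 ((1 : Matrix (Fin m) (Fin m) ℝ) ⊗ₖ V) := by
  have h_one_add : 1 + U * A * V = U * (1 + A) * V := by
    rw [mul_add, add_mul, mul_one, hUV]
  have h_add_one : U * D * V + 1 = U * (D + 1) * V := by
    rw [mul_add, add_mul, mul_one, hUV]
  have h_right (B : Matrix (Fin n) (Fin n) ℝ) :
      (of fun i (p : Fin m × Fin n) => (U * B * V) i p.2) =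
        U * (of fun i (p : Fin m × Fin n) => B i p.2) *
          ((1 : Matrix (Fin m) (Fin m) ℝ) ⊗ₖ V) := by
    ext i p
    simp [Matrix.mul_apply, Fintype.sum_prod_type, Matrix.one_apply]
  have h_left (B : Matrix (Fin n) (Fin n) ℝ) :
      (of fun (p : Fin m × Fin n) j => (U * B * V) p.2 j) =
        ((1 : Matrix (Fin m) (Fin m) ℝ) ⊗ₖ U) *
          (of fun (p : Fin m × Fin n) j => B p.2 j) * V := by
    ext p j
    simp [Matrix.mul_apply, Fintype.sum_prod_type, Matrix.one_apply]
  unfold cncLap cncDeg cncAdj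
  simp only [mul_sub, sub_mul, fromBlocks_multiply, h_one_add, h_add_one, h_right, h_left]
  simp [mul_add, add_mul, ← mul_kronecker_mul, hUV]

theorem charpoly_cncLap_conj {n m : ℕ} {U V : Matrix (Fin n) (Fin n) ℝ} (hUV : U * V = 1)
    (A D : Matrix (Fin n) (Fin n) ℝ) (A₂ D₂ : Matrix (Fin m) (Fin m) ℝ) :
    (cncLap (U * A * V) (U * D * V) A₂ D₂).charpoly = (cncLap A D A₂ D₂).charpoly := by
  rw [cncLap_conj hUV, charpoly_mul_comm, ← mul_assoc, fromBlocks_multiply]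
  simp [← mul_kronecker_mul, mul_eq_one_comm.1 hUV]

/-- If `G₁` and `G₂` are `r`-regular and Laplacian cospectral, then `G₁ ⊠ G` and `G₂ ⊠ G`
are Laplacian cospectral for every graph `G`. -/
theorem cnc_lap_cospectral_left {n m r : ℕ} (G₁ G₂ : SimpleGraph (Fin n))
    [DecidableRel G₁.Adj] [DecidableRel G₂.Adj]
    (hreg₁ : G₁.IsRegularOfDegree r) (hreg₂ : G₂.IsRegularOfDegree r)
    (h : (G₁.lapMatrix ℝ).charpoly = (G₂.lapMatrix ℝ).charpoly)
    (G : SimpleGraph (Fin m)) [DecidableRel G.Adj] :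
    (cncLap (G₁.adjMatrix ℝ) (G₁.degMatrix ℝ) (G.adjMatrix ℝ) (G.degMatrix ℝ)).charpoly
      = (cncLap (G₂.adjMatrix ℝ) (G₂.degMatrix ℝ) (G.adjMatrix ℝ) (G.degMatrix ℝ)).charpoly := by
  obtain ⟨⟨U, hU⟩, hconj⟩ :=
    (G₁.isHermitian_lapMatrix ℝ).exists_unitary_conj_of_charpoly_eq
      (G₂.isHermitian_lapMatrix ℝ) h
  have hUV : U * star U = 1 := Unitary.mul_star_self_of_mem hU
  have hD : G₂.degMatrix ℝ = U * G₁.degMatrix ℝ * star U := by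
    simp [hreg₁.degMatrix_eq ℝ, hreg₂.degMatrix_eq ℝ, hUV]
  have hA : G₂.adjMatrix ℝ = U * G₁.adjMatrix ℝ * star U := by
    simp only [Unitary.conjStarAlgAut_apply, SimpleGraph.lapMatrix, mul_sub, sub_mul, ← hD]
      at hconj
    exact sub_right_injective hconj
  rw [hA, hD, charpoly_cncLap_conj hUV]
end

section
/- Let G be an r-regular simple graph of order m, and let G₁ and G₂ be signless Laplacian cospectral simple graphs of the same order n whose signless Laplacian coronals are equal, i.e., χ_{Q₁}(x) = χ_{Q₂}(x) for every real x with det(xIₙ − Q₁) ≠ 0 and det(xIₙ − Q₂) ≠ 0. Then the signless Laplacian matrices Q(G⊠G₁) and Q(G⊠G₂) of the closed neighborhood coronas have equal characteristic polynomials. -/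
open Matrix Polynomial Finset
open scoped Kronecker

/-- Sandwiching `N ⊗ I` between the row of copies of `B` and the column of copies of `C` gives the
sum of the entries of `N` times `B * C`. -/
theorem copies_mul_kronecker_one_mul_copies {m n : ℕ} (B C : Matrix (Fin m) (Fin m) ℝ)
    (N : Matrix (Fin n) (Fin n) ℝ) :
    (Matrix.of fun i (p : Fin n × Fin m) => B i p.2) * (N ⊗ₖ (1 : Matrix (Fin m) (Fin m) ℝ)) *
      (Matrix.of fun (p : Fin n × Fin m) j => C p.2 j) = (∑ p, ∑ q, N p q) • (B * C) := by
  ext i j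
  simp only [Matrix.mul_apply, Matrix.smul_apply, Matrix.of_apply, kroneckerMap_apply,
    Fintype.sum_prod_type, Matrix.one_apply, mul_ite, mul_one, mul_zero, Finset.sum_ite_eq',
    Finset.mem_univ, if_true, smul_eq_mul]
  rw [Finset.sum_comm (f := N), Finset.sum_mul]
  refine Finset.sum_congr rfl fun q _ => ?_
  rw [Finset.mul_sum]
  refine Finset.sum_congr rfl fun b _ => ?_
  rw [← Finset.mul_sum]
  ring

/-- The characteristic polynomial of the signless Laplacian of a closed neighborhood corona with
regular first factor, away from the shifted spectrum of the second factor. -/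
theorem eval_charpoly_cncSignlessLap {m n : ℕ} (A : Matrix (Fin m) (Fin m) ℝ) (r : ℝ)
    (A₂ D₂ : Matrix (Fin n) (Fin n) ℝ) (x : ℝ)
    (hx : ((x - (r + 1)) • (1 : Matrix (Fin n) (Fin n) ℝ) - (D₂ + A₂)).det ≠ 0) :
    (cncSignlessLap A (r • 1) A₂ D₂).charpoly.eval x =
      ((x - (r + 1)) • (1 : Matrix (Fin n) (Fin n) ℝ) - (D₂ + A₂)).det ^ m *
        (x • (1 : Matrix (Fin m) (Fin m) ℝ) - (((n : ℝ) + 1) • (r • 1) + (n : ℝ) • 1 + A) -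
          coronal (D₂ + A₂) (x - (r + 1)) • ((1 + A) * (1 + A))).det := by
  set N := (x - (r + 1)) • (1 : Matrix (Fin n) (Fin n) ℝ) - (D₂ + A₂) with hN
  have hu : IsUnit (N ⊗ₖ (1 : Matrix (Fin m) (Fin m) ℝ)) := by
    rw [Matrix.isUnit_iff_isUnit_det, det_kronecker, det_one, one_pow, mul_one]
    exact (isUnit_iff_ne_zero.mpr hx).pow _
  have hblock : scalar _ x - cncSignlessLap A (r • 1) A₂ D₂ = Matrix.fromBlocks
      (x • (1 : Matrix (Fin m) (Fin m) ℝ) - (((n : ℝ) + 1) • (r • 1) + (n : ℝ) • 1 + A))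
      (-Matrix.of fun i p => (1 + A) i p.2) (-Matrix.of fun p j => (1 + A) p.2 j)
      (N ⊗ₖ (1 : Matrix (Fin m) (Fin m) ℝ)) := by
    ext (i | ⟨p, a⟩) (j | ⟨q, b⟩)
    · simp [cncSignlessLap, cncDeg, cncAdj, Matrix.one_apply, Matrix.diagonal_apply]
    · simp [cncSignlessLap, cncDeg, cncAdj]
    · simp [cncSignlessLap, cncDeg, cncAdj]
    · by_cases hpq : p = q <;> by_cases hab : a = b <;>
        simp [cncSignlessLap, cncDeg, cncAdj, hN, Matrix.one_apply, hpq, hab]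
      ring
  let _ := hu.invertible
  rw [eval_charpoly, hblock, det_fromBlocks₂₂, det_kronecker, invOf_eq_nonsing_inv, inv_kronecker,
    inv_one, Matrix.neg_mul, Matrix.neg_mul, Matrix.mul_neg, neg_neg, copies_mul_kronecker_one_mul_copies]
  simp [coronal, hN]

/-- If `G` is `r`-regular and `G₁`, `G₂` are signless Laplacian cospectral with equal signless
Laplacian coronals, then `G ⊠ G₁` and `G ⊠ G₂` are signless Laplacian cospectral. -/
theorem cnc_signlessLap_cospectral_right {m n r : ℕ} (G : SimpleGraph (Fin m)) [DecidableRel G.Adj]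
    (hreg : G.IsRegularOfDegree r)
    (G₁ G₂ : SimpleGraph (Fin n)) [DecidableRel G₁.Adj] [DecidableRel G₂.Adj]
    (h : (signlessLap G₁).charpoly = (signlessLap G₂).charpoly)
    (hcor : ∀ x : ℝ, (x • (1 : Matrix (Fin n) (Fin n) ℝ) - signlessLap G₁).det ≠ 0 →
      (x • (1 : Matrix (Fin n) (Fin n) ℝ) - signlessLap G₂).det ≠ 0 →
      coronal (signlessLap G₁) x = coronal (signlessLap G₂) x) :
    (cncSignlessLap (G.adjMatrix ℝ) (G.degMatrix ℝ) (G₁.adjMatrix ℝ) (G₁.degMatrix ℝ)).charpoly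
      = (cncSignlessLap (G.adjMatrix ℝ) (G.degMatrix ℝ) (G₂.adjMatrix ℝ) (G₂.degMatrix ℝ)).charpoly := by
  have hdeg : G.degMatrix ℝ = (r : ℝ) • 1 := by
    ext i j
    simp [SimpleGraph.degMatrix, Matrix.diagonal_apply, Matrix.one_apply, hreg.degree_eq i]
  have hdet (M : Matrix (Fin n) (Fin n) ℝ) (y : ℝ) :
      (y • (1 : Matrix (Fin n) (Fin n) ℝ) - M).det = M.charpoly.eval y := by
    rw [eval_charpoly, Matrix.scalar_apply, Matrix.smul_one_eq_diagonal]
  rw [hdeg]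
  unfold signlessLap at h hcor
  have hne : (G₁.degMatrix ℝ + G₁.adjMatrix ℝ).charpoly.comp (X - C ((r : ℝ) + 1)) ≠ 0 :=
    ((charpoly_monic _).comp_X_sub_C _).ne_zero
  refine mul_right_cancel₀ hne (Polynomial.funext fun x => ?_)
  simp only [eval_mul, eval_comp, eval_sub, eval_X, eval_C]
  by_cases hx : (G₁.degMatrix ℝ + G₁.adjMatrix ℝ).charpoly.eval (x - ((r : ℝ) + 1)) = 0
  · simp [hx]
  have h₁ := hx
  have h₂ := h ▸ hx
  rw [← hdet] at h₁ h₂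
  rw [eval_charpoly_cncSignlessLap _ _ _ _ _ h₁, eval_charpoly_cncSignlessLap _ _ _ _ _ h₂]
  rw [hcor _ h₁ h₂, hdet, hdet, h]
end
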